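/- Let x⁰, x¹, … be a PPA sequence for min_{x∈Ω} q(x) with inf_{x∈Ω} q(x) > −∞, and let x̄ be an accumulation point of (x^k) which is a KKT point at which the strict complementarity conditions hold (so x^k → x̄). Let S = A_m(x̄) = {j : l_j < x̄_j < u_j} and assume Q_{SS} has at least one positive eigenvalue; let λ₊ be its smallest positive eigenvalue and set ρ̄ = γ/(γ + λ₊) ∈ (0,1). Then there exists N such that for all k ≥ N: ‖x^{k+2} − x^{k+1}‖ ≤ ρ̄ ‖x^{k+1} − x^k‖ and ‖x^{k+1} − x̄‖ ≤ ρ̄ ‖x^k − x̄‖. (Theorem 3.8, part (i).) -/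

import Mathlib

open Matrix Filter Topology

/-- Euclidean norm of a finitely-indexed real vector. -/
noncomputable def vnorm {ι : Type*} [Fintype ι] (v : ι → ℝ) : ℝ :=
  Real.sqrt (v ⬝ᵥ v)

/-- Membership in the (possibly unbounded) box `Ω = {x | l ≤ x ≤ u}`,
with extended-real bounds. -/
def inBox {n : ℕ} (l u : Fin n → EReal) (x : Fin n → ℝ) : Prop :=
  ∀ j, l j ≤ (x j : EReal) ∧ (x j : EReal) ≤ u j

/-- The quadratic objective `q(x) = ½ xᵀQx + rᵀx`. -/
noncomputable def qf {n : ℕ} (Q : Matrix (Fin n) (Fin n) ℝ) (r : Fin n → ℝ)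
    (x : Fin n → ℝ) : ℝ :=
  (1 / 2) * (x ⬝ᵥ Q *ᵥ x) + r ⬝ᵥ x

/-- `xbar` is a KKT point at which the strict complementarity conditions hold. -/
def kktStrict {n : ℕ} (l u : Fin n → EReal) (Q : Matrix (Fin n) (Fin n) ℝ)
    (r : Fin n → ℝ) (xbar : Fin n → ℝ) : Prop :=
  ∀ j, ((xbar j : EReal) = l j → 0 < (Q *ᵥ xbar + r) j) ∧
    (l j < (xbar j : EReal) ∧ (xbar j : EReal) < u j → (Q *ᵥ xbar + r) j = 0) ∧
    ((xbar j : EReal) = u j → (Q *ᵥ xbar + r) j < 0)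


lemma vnorm_sq' {ι : Type*} [Fintype ι] (v : ι → ℝ) : vnorm v ^ 2 = v ⬝ᵥ v := by
  unfold vnorm
  rw [Real.sq_sqrt]
  exact Finset.sum_nonneg fun i _ => mul_self_nonneg _

lemma vnorm_nonneg' {ι : Type*} [Fintype ι] (v : ι → ℝ) : 0 ≤ vnorm v := Real.sqrt_nonneg _

lemma vnorm_eq' {ι : Type*} [Fintype ι] (v : ι → ℝ) : vnorm v = ‖WithLp.toLp 2 v‖ := by
  rw [EuclideanSpace.norm_eq]
  simp [vnorm, dotProduct, pow_two]

lemma vnorm_add_le' {ι : Type*} [Fintype ι] (v w : ι → ℝ) :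
    vnorm (v + w) ≤ vnorm v + vnorm w := by
  simp only [vnorm_eq', WithLp.toLp_add]
  exact norm_add_le _ _

lemma abs_le_vnorm' {ι : Type*} [Fintype ι] (v : ι → ℝ) (j : ι) : |v j| ≤ vnorm v := by
  apply abs_le_of_sq_le_sq' _ (vnorm_nonneg' v) |> abs_le.2
  rw [vnorm_sq', pow_two]
  exact Finset.single_le_sum (f := fun i => v i * v i) (fun i _ => mul_self_nonneg _)
    (Finset.mem_univ j)

lemma spec_exists {ι : Type*} [Fintype ι] [DecidableEq ι] (A : Matrix ι ι ℝ) (hA : A.IsSymm) :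
    ∃ (μ : ι → ℝ) (v : ι → ι → ℝ), (∀ i, A *ᵥ v i = μ i • v i) ∧ (∀ i, v i ≠ 0) ∧
      (∀ w z : ι → ℝ, w ⬝ᵥ z = ∑ i, (v i ⬝ᵥ w) * (v i ⬝ᵥ z)) := by
  have hH : A.IsHermitian := by
    rw [Matrix.IsHermitian, Matrix.conjTranspose_eq_transpose_of_trivial]; exact hA
  refine ⟨hH.eigenvalues, fun i => WithLp.ofLp (hH.eigenvectorBasis i), ?_, ?_, ?_⟩
  · intro i
    exact hH.mulVec_eigenvectorBasis i
  · intro i h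
    have := hH.eigenvectorBasis.orthonormal.ne_zero i
    apply this
    ext j
    exact congrFun h j
  · intro w z
    have := hH.eigenvectorBasis.sum_inner_mul_inner (WithLp.toLp 2 w) (WithLp.toLp 2 z)
    simp only [EuclideanSpace.inner_eq_star_dotProduct, star_trivial] at this
    rw [dotProduct_comm, ← this]
    refine Finset.sum_congr rfl fun i _ => ?_
    rw [dotProduct_comm z]

lemma qf_add {n : ℕ} (Q : Matrix (Fin n) (Fin n) ℝ) (hQ : Q.IsSymm) (r x h : Fin n → ℝ) :
    qf Q r (x + h) = qf Q r x + (Q *ᵥ x + r) ⬝ᵥ h + (1/2) * (h ⬝ᵥ Q *ᵥ h) := by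
  have h1 : x ⬝ᵥ Q *ᵥ h = (Q *ᵥ x) ⬝ᵥ h := by
    rw [dotProduct_mulVec, ← mulVec_transpose, hQ.eq]
  have h2 : h ⬝ᵥ Q *ᵥ x = (Q *ᵥ x) ⬝ᵥ h := dotProduct_comm _ _
  simp only [qf, mulVec_add, dotProduct_add, add_dotProduct, h1, h2]
  ring

lemma foc_aux {g a δ : ℝ} (hδ : 0 < δ) (h : ∀ t, 0 ≤ t → t ≤ δ → 0 ≤ g * t + a * t ^ 2) :
    0 ≤ g := by
  by_contra hg
  push Not at hg
  have hb : 0 < |a| + 1 := by positivity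
  set t := min δ (-g / (2 * (|a| + 1))) with ht
  have ht0 : 0 < t := lt_min hδ (by apply div_pos <;> linarith)
  have h1 := h t ht0.le (min_le_left _ _)
  have h2 : t * (2 * (|a| + 1)) ≤ -g := by
    rw [← le_div_iff₀ (by positivity)]; exact min_le_right _ _
  have h3 : 0 ≤ g + a * t := by
    by_contra hc
    push Not at hc
    nlinarith
  nlinarith [le_abs_self a]

/-- gradient of the proximal subproblem -/
noncomputable def pg {n : ℕ} (Q : Matrix (Fin n) (Fin n) ℝ) (r : Fin n → ℝ) (γ : ℝ)
    (y z : Fin n → ℝ) : Fin n → ℝ := Q *ᵥ z + r + γ • (z - y)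

lemma step_ineq {n : ℕ} {l u : Fin n → EReal} {Q : Matrix (Fin n) (Fin n) ℝ} (hQ : Q.IsSymm)
    {r : Fin n → ℝ} {γ : ℝ} {y z : Fin n → ℝ}
    (h : ∀ w, inBox l u w → qf Q r z + γ / 2 * vnorm (z - y) ^ 2 ≤
        qf Q r w + γ / 2 * vnorm (w - y) ^ 2) (j : Fin n) (t : ℝ)
    (hw : inBox l u (z + Pi.single j t)) :
    0 ≤ pg Q r γ y z j * t + ((Q j j + γ) / 2) * t ^ 2 := by
  have := h _ hw
  rw [qf_add Q hQ, vnorm_sq', vnorm_sq', add_sub_right_comm] at this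
  simp only [dotProduct_add, add_dotProduct, dotProduct_single, single_dotProduct,
    mulVec_single, Pi.single_eq_same, Pi.smul_apply, Pi.add_apply, Pi.sub_apply] at this
  simp [pg] at this ⊢
  nlinarith

lemma box_move {n : ℕ} {l u : Fin n → EReal} {z : Fin n → ℝ} (hz : inBox l u z) (j : Fin n)
    (t : ℝ) (h1 : l j ≤ ((z j + t : ℝ) : EReal)) (h2 : ((z j + t : ℝ) : EReal) ≤ u j) :
    inBox l u (z + Pi.single j t) := by
  intro i
  by_cases hij : i = j
  · subst hij
    simpa using ⟨h1, h2⟩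
  · simpa [hij] using hz i

lemma foc_up {n : ℕ} {l u : Fin n → EReal} {Q : Matrix (Fin n) (Fin n) ℝ} (hQ : Q.IsSymm)
    {r : Fin n → ℝ} {γ : ℝ} {y z : Fin n → ℝ} (hz : inBox l u z)
    (h : ∀ w, inBox l u w → qf Q r z + γ / 2 * vnorm (z - y) ^ 2 ≤
        qf Q r w + γ / 2 * vnorm (w - y) ^ 2) (j : Fin n) (hj : (z j : EReal) < u j) :
    0 ≤ pg Q r γ y z j := by
  obtain ⟨m, hm1, hm2⟩ := EReal.lt_iff_exists_real_btwn.1 hj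
  rw [EReal.coe_lt_coe_iff] at hm1
  refine foc_aux (δ := m - z j) (a := (Q j j + γ) / 2) (by linarith) fun t ht0 ht => ?_
  refine step_ineq hQ h j t (box_move hz j t ?_ ?_)
  · exact (hz j).1.trans (EReal.coe_le_coe_iff.2 (by linarith))
  · exact (EReal.coe_le_coe_iff.2 (by linarith)).trans hm2.le

lemma foc_down {n : ℕ} {l u : Fin n → EReal} {Q : Matrix (Fin n) (Fin n) ℝ} (hQ : Q.IsSymm)
    {r : Fin n → ℝ} {γ : ℝ} {y z : Fin n → ℝ} (hz : inBox l u z)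
    (h : ∀ w, inBox l u w → qf Q r z + γ / 2 * vnorm (z - y) ^ 2 ≤
        qf Q r w + γ / 2 * vnorm (w - y) ^ 2) (j : Fin n) (hj : l j < (z j : EReal)) :
    pg Q r γ y z j ≤ 0 := by
  obtain ⟨m, hm1, hm2⟩ := EReal.lt_iff_exists_real_btwn.1 hj
  rw [EReal.coe_lt_coe_iff] at hm2
  rw [← neg_nonneg]
  refine foc_aux (δ := z j - m) (a := (Q j j + γ) / 2) (by linarith) fun t ht0 ht => ?_
  have := step_ineq hQ h j (-t) (box_move hz j (-t) ?_ ?_)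
  · linarith [this, neg_sq t, show pg Q r γ y z j * -t = - pg Q r γ y z j * t by ring, show ((Q j j + γ) / 2) * (-t) ^ 2 = ((Q j j + γ) / 2) * t ^ 2 by ring]
  · exact hm1.le.trans (EReal.coe_le_coe_iff.2 (by linarith))
  · exact (EReal.coe_le_coe_iff.2 (by linarith)).trans (hz j).2

lemma pg_cont {n : ℕ} (Q : Matrix (Fin n) (Fin n) ℝ) (r : Fin n → ℝ) (γ : ℝ) (j : Fin n) :
    Continuous fun p : (Fin n → ℝ) × (Fin n → ℝ) => pg Q r γ p.1 p.2 j := by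
  unfold pg
  simp only [mulVec, dotProduct, Pi.add_apply, Pi.smul_apply, Pi.sub_apply]
  fun_prop

/-- identification of the active face near xbar -/
lemma ident {n : ℕ} {l u : Fin n → EReal} {Q : Matrix (Fin n) (Fin n) ℝ} (hQ : Q.IsSymm)
    {r : Fin n → ℝ} {γ : ℝ} {xbar : Fin n → ℝ} (hxbar : inBox l u xbar)
    (hkkt : kktStrict l u Q r xbar) :
    ∃ ε > 0, ∀ y z : Fin n → ℝ, vnorm (y - xbar) < ε → vnorm (z - xbar) < ε → inBox l u z →
      (∀ w, inBox l u w → qf Q r z + γ / 2 * vnorm (z - y) ^ 2 ≤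
        qf Q r w + γ / 2 * vnorm (w - y) ^ 2) →
      ∀ j, ((l j < (xbar j : EReal) ∧ (xbar j : EReal) < u j) → pg Q r γ y z j = 0) ∧
        (¬ (l j < (xbar j : EReal) ∧ (xbar j : EReal) < u j) → z j = xbar j) := by
  have key : ∀ᶠ p : (Fin n → ℝ) × (Fin n → ℝ) in 𝓝 (xbar, xbar), ∀ j,
      inBox l u p.2 → (∀ w, inBox l u w → qf Q r p.2 + γ / 2 * vnorm (p.2 - p.1) ^ 2 ≤
        qf Q r w + γ / 2 * vnorm (w - p.1) ^ 2) →
      ((l j < (xbar j : EReal) ∧ (xbar j : EReal) < u j) → pg Q r γ p.1 p.2 j = 0) ∧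
        (¬ (l j < (xbar j : EReal) ∧ (xbar j : EReal) < u j) → p.2 j = xbar j) := by
    rw [eventually_all]
    intro j
    have hc := (pg_cont Q r γ j).tendsto (xbar, xbar)
    have hx0 : pg Q r γ xbar xbar j = (Q *ᵥ xbar + r) j := by simp [pg]
    simp only [hx0] at hc
    have hz : Tendsto (fun p : (Fin n → ℝ) × (Fin n → ℝ) => ((p.2 j : ℝ) : EReal))
        (𝓝 (xbar, xbar)) (𝓝 ((xbar j : ℝ) : EReal)) := by
      have : Continuous (fun p : (Fin n → ℝ) × (Fin n → ℝ) => ((p.2 j : ℝ) : EReal)) :=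
        continuous_coe_real_ereal.comp (by fun_prop)
      exact this.tendsto (xbar, xbar)
    by_cases hj : l j < (xbar j : EReal) ∧ (xbar j : EReal) < u j
    · filter_upwards [hz.eventually_const_lt hj.1, hz.eventually_lt_const hj.2] with p h1 h2 hb hw
      exact ⟨fun _ => le_antisymm (foc_down hQ hb hw j h1) (foc_up hQ hb hw j h2),
        fun h => absurd hj h⟩
    · by_cases hlj : l j < (xbar j : EReal)
      · have hu' : (xbar j : EReal) = u j :=
          le_antisymm (hxbar j).2 (not_lt.1 fun h => hj ⟨hlj, h⟩)
        filter_upwards [hc.eventually_lt_const ((hkkt j).2.2 hu')] with p h1 hb hw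
        refine ⟨fun h => absurd h hj, fun _ => ?_⟩
        have : ¬ ((p.2 j : EReal) < u j) := fun h => absurd (foc_up hQ hb hw j h) (not_le.2 h1)
        have h3 := le_antisymm (hb j).2 (not_lt.1 this)
        rw [← hu'] at h3
        exact_mod_cast h3
      · have hl' : (xbar j : EReal) = l j := le_antisymm (not_lt.1 hlj) (hxbar j).1
        filter_upwards [hc.eventually_const_lt ((hkkt j).1 hl')] with p h1 hb hw
        refine ⟨fun h => absurd h hj, fun _ => ?_⟩
        have : ¬ (l j < (p.2 j : EReal)) := fun h => absurd (foc_down hQ hb hw j h) (not_le.2 h1)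
        have h3 := le_antisymm (not_lt.1 this) (hb j).1
        rw [← hl'] at h3
        exact_mod_cast h3
  obtain ⟨ε, hε, H⟩ := Metric.eventually_nhds_iff.1 key
  refine ⟨ε, hε, fun y z hy hz hb hw j => ?_⟩
  have hd : ∀ w : Fin n → ℝ, vnorm (w - xbar) < ε → dist w xbar < ε := by
    intro w hw
    rw [dist_pi_lt_iff hε]
    intro i
    rw [Real.dist_eq]
    exact (abs_le_vnorm' (w - xbar) i).trans_lt hw
  exact H (y := (y, z)) (by rw [Prod.dist_eq]; exact max_lt (hd y hy) (hd z hz)) j hb hw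

lemma supp_dot {n : ℕ} (S : Finset (Fin n)) (e f : Fin n → ℝ) (he : ∀ j, j ∉ S → e j = 0) :
    e ⬝ᵥ f = (fun j : {j // j ∈ S} => e j) ⬝ᵥ (fun j : {j // j ∈ S} => f j) := by
  simp only [dotProduct]
  rw [Finset.sum_coe_sort S (fun j => e j * f j)]
  symm
  refine Finset.sum_subset (Finset.subset_univ _) fun j _ hj => ?_
  rw [he j hj, zero_mul]

lemma supp_mulVec {n : ℕ} (S : Finset (Fin n)) (Q : Matrix (Fin n) (Fin n) ℝ) (e : Fin n → ℝ)
    (he : ∀ j, j ∉ S → e j = 0) (j : {j // j ∈ S}) :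
    (Q *ᵥ e) j = (Q.submatrix (Subtype.val : {j // j ∈ S} → Fin n) Subtype.val *ᵥ
      (fun j : {j // j ∈ S} => e j)) j := by
  simp only [mulVec]
  rw [dotProduct_comm, supp_dot S _ _ he, dotProduct_comm]
  rfl

/-- sequence lemma -/
lemma seq_conv (E D : ℕ → ℝ) (ε a θ : ℝ) (ha : 0 ≤ a) (hθ0 : 0 ≤ θ) (hθ : θ < 1)
    (hD : ∀ k, 0 ≤ D k)
    (h1 : ∀ k, E (k + 1) ≤ E k + a * D k)
    (h2 : ∀ k, E k < ε → E (k + 1) < ε → D (k + 1) ≤ θ * D k)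
    (hsm : ∀ δ > 0, ∃ K, E K < δ ∧ D K < δ) :
    ∀ δ > 0, δ ≤ ε → ∃ K, ∀ k ≥ K, E k < δ := by
  intro δ hδ hδε
  set c := a / (1 - θ) with hc
  have h1θ : 0 < 1 - θ := by linarith
  have hc0 : 0 ≤ c := div_nonneg ha h1θ.le
  have hca : a + c * θ = c := by rw [hc]; field_simp; ring
  obtain ⟨K, hK1, hK2⟩ := hsm (δ / (1 + c + 1)) (by positivity)
  have hV : E K + c * D K < δ := by
    have h3 : (1 + c + 1) * (δ / (1 + c + 1)) = δ := by field_simp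
    have h5 : 0 < δ / (1 + c + 1) := by positivity
    nlinarith
  have hind : ∀ k ≥ K, E k + c * D k < δ := by
    intro k hk
    induction k, hk using Nat.le_induction with
    | base => exact hV
    | succ k hk ih =>
      have hcD : 0 ≤ c * D k := mul_nonneg hc0 (hD k)
      have hac : a * D k ≤ c * D k := by
        apply mul_le_mul_of_nonneg_right _ (hD k)
        have := mul_nonneg hc0 hθ0
        linarith
      have h4 := h2 k (by linarith) (by linarith [h1 k])
      have h5 := mul_le_mul_of_nonneg_left h4 hc0
      have h6 : a * D k + c * (θ * D k) = c * D k := by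
        rw [← mul_assoc, ← add_mul, hca]
      linarith [h1 k]
  refine ⟨K, fun k hk => ?_⟩
  have := hind k hk
  have := mul_nonneg hc0 (hD k)
  linarith

/-- Theorem 3.8 (i): local linear convergence of the PPA iterates with factor
`ρ̄ = γ/(γ + λ₊)`, where `λ₊` is the smallest positive eigenvalue of `Q_SS`,
`S = A_m(x̄)`. -/
theorem ppa_local_linear_convergence {n : ℕ} (hn : 1 ≤ n)
    (l u : Fin n → EReal)
    (hl : ∀ j, l j ≠ ⊤) (hu : ∀ j, u j ≠ ⊥) (hlu : ∀ j, l j < u j)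
    (Q : Matrix (Fin n) (Fin n) ℝ) (hQ : Q.IsSymm) (r : Fin n → ℝ)
    (γ : ℝ) (hγ : 0 < γ)
    (hpd : (Q + γ • (1 : Matrix (Fin n) (Fin n) ℝ)).PosDef)
    (hbdd : ∃ B : ℝ, ∀ z, inBox l u z → B ≤ qf Q r z)
    (x : ℕ → Fin n → ℝ) (hmem : ∀ k, inBox l u (x k))
    (hppa : ∀ k, ∀ z, inBox l u z →
      qf Q r (x (k + 1)) + γ / 2 * vnorm (x (k + 1) - x k) ^ 2 ≤
        qf Q r z + γ / 2 * vnorm (z - x k) ^ 2)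
    (xbar : Fin n → ℝ) (hxbar : inBox l u xbar)
    (hacc : ∃ φ : ℕ → ℕ, StrictMono φ ∧
      Tendsto (fun i => x (φ i)) atTop (𝓝 xbar))
    (hkkt : kktStrict l u Q r xbar)
    (S : Finset (Fin n))
    (hS : ∀ j, j ∈ S ↔ (l j < (xbar j : EReal) ∧ (xbar j : EReal) < u j))
    (lam : ℝ) (hlam : 0 < lam)
    (heig : Module.End.HasEigenvalue
      (Matrix.toLin' (Q.submatrix (Subtype.val : {j // j ∈ S} → Fin n)
        Subtype.val)) lam)
    (hmin : ∀ μ : ℝ, 0 < μ →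
      Module.End.HasEigenvalue
        (Matrix.toLin' (Q.submatrix (Subtype.val : {j // j ∈ S} → Fin n)
          Subtype.val)) μ → lam ≤ μ) :
    ∃ N : ℕ, ∀ k, N ≤ k →
      vnorm (x (k + 2) - x (k + 1)) ≤ γ / (γ + lam) * vnorm (x (k + 1) - x k) ∧
      vnorm (x (k + 1) - xbar) ≤ γ / (γ + lam) * vnorm (x k - xbar) := by
  classical
  set A : Matrix {j // j ∈ S} {j // j ∈ S} ℝ :=
    Q.submatrix (Subtype.val : {j // j ∈ S} → Fin n) Subtype.val with hA
  have hAs : A.IsSymm := hQ.submatrix _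
  obtain ⟨μ, v, hv, hv0, hpars⟩ := spec_exists A hAs
  have hvA : ∀ i w, v i ⬝ᵥ A *ᵥ w = μ i * (v i ⬝ᵥ w) := by
    intro i w
    rw [dotProduct_mulVec, ← mulVec_transpose, hAs.eq, hv, smul_dotProduct, smul_eq_mul]
  have hdich : ∀ i, μ i ≤ 0 ∨ lam ≤ μ i := by
    intro i
    by_cases h : μ i ≤ 0
    · exact Or.inl h
    · right
      refine hmin _ (not_le.1 h) ?_
      refine Module.End.hasEigenvalue_of_hasEigenvector (x := v i) ?_
      rw [Module.End.hasEigenvector_iff, Module.End.mem_eigenspace_iff]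
      exact ⟨by rw [Matrix.toLin'_apply]; exact hv i, hv0 i⟩
  have hμ : ∀ i, 0 < γ + μ i := by
    intro i
    set W : Fin n → ℝ := fun j => if h : j ∈ S then v i ⟨j, h⟩ else 0 with hW
    have hWS : ∀ j, j ∉ S → W j = 0 := fun j hj => by simp [hW, hj]
    have hWr : (fun j : {j // j ∈ S} => W j) = v i := by
      funext j; simp [hW]
    have hW0 : W ≠ 0 := by
      intro h
      apply hv0 i
      rw [← hWr, h]; rfl
    have h1 := hpd.dotProduct_mulVec_pos hW0
    have h3 : W ⬝ᵥ W = v i ⬝ᵥ v i := by rw [supp_dot S W W hWS, hWr]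
    have h4 : W ⬝ᵥ Q *ᵥ W = μ i * (v i ⬝ᵥ v i) := by
      rw [supp_dot S W _ hWS, ← hvA i, hWr]
      congr 1
      funext j
      rw [supp_mulVec S Q W hWS j, hWr]
    rw [star_trivial, add_mulVec, dotProduct_add, smul_mulVec, one_mulVec, dotProduct_smul,
      h3, h4, smul_eq_mul, ← add_mul] at h1
    have h5 : 0 ≤ v i ⬝ᵥ v i := Finset.sum_nonneg fun i _ => mul_self_nonneg _
    by_contra hc
    nlinarith
  have hKL : ∀ w, lam * (w ⬝ᵥ A *ᵥ w) ≤ (A *ᵥ w) ⬝ᵥ (A *ᵥ w) := by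
    intro w
    rw [hpars w, hpars (A *ᵥ w), Finset.mul_sum]
    refine Finset.sum_le_sum fun i _ => ?_
    rw [hvA]
    have : 0 ≤ μ i * (μ i - lam) := by
      rcases hdich i with h | h
      · nlinarith
      · exact mul_nonneg (by linarith) (by linarith)
    nlinarith [mul_nonneg this (mul_self_nonneg (v i ⬝ᵥ w))]
  -- descent
  obtain ⟨φ, hφ, hlim⟩ := hacc
  have hdesc : ∀ k, qf Q r (x (k + 1)) + γ / 2 * vnorm (x (k + 1) - x k) ^ 2 ≤ qf Q r (x k) := by
    intro k
    have := hppa k (x k) (hmem k)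
    simpa [vnorm] using this
  have hanti : Antitone fun k => qf Q r (x k) := by
    refine antitone_nat_of_succ_le fun k => ?_
    have := hdesc k
    have : 0 ≤ γ / 2 * vnorm (x (k + 1) - x k) ^ 2 := by positivity
    linarith
  have hqc : Continuous (qf Q r) := by
    unfold qf
    simp only [mulVec, dotProduct]
    fun_prop
  have hqlim : Tendsto (fun i => qf Q r (x (φ i))) atTop (𝓝 (qf Q r xbar)) :=
    (hqc.tendsto xbar).comp hlim
  have hge : ∀ k, qf Q r xbar ≤ qf Q r (x k) := by
    intro k
    refine le_of_tendsto hqlim ?_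
    filter_upwards [eventually_ge_atTop k] with i hi
    exact hanti (hi.trans (hφ.id_le i))
  obtain ⟨ε, hε, hid⟩ := ident (γ := γ) hQ hxbar hkkt
  set E : ℕ → ℝ := fun k => vnorm (x k - xbar) with hE
  have hid' : ∀ k, E k < ε → E (k + 1) < ε →
      (∀ j, j ∉ S → (x (k + 1) - xbar) j = 0) ∧
      A *ᵥ (fun j : {j // j ∈ S} => (x (k + 1) - xbar) j) =
        fun j : {j // j ∈ S} => - (γ * (x (k + 1) - x k) j) := by
    intro k h1 h2
    have h := hid (x k) (x (k + 1)) h1 h2 (hmem _) (hppa k)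
    have hs : ∀ j, j ∉ S → (x (k + 1) - xbar) j = 0 := by
      intro j hj
      rw [hS] at hj
      simp [(h j).2 hj]
    refine ⟨hs, ?_⟩
    funext j
    have hjS := (hS j).1 j.2
    have h3 := (h j).1 hjS
    have h4 := (hkkt j).2.1 hjS
    rw [← supp_mulVec S Q _ hs j, mulVec_sub]
    simp [pg] at h3 h4 ⊢
    linarith
  have hcontr : ∀ k, E k < ε → E (k + 1) < ε →
      qf Q r (x (k + 1)) - qf Q r xbar ≤ γ / (γ + lam) * (qf Q r (x k) - qf Q r xbar) := by
    intro k h1 h2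
    obtain ⟨hs, hAe⟩ := hid' k h1 h2
    have hq := qf_add Q hQ r xbar (x (k + 1) - xbar)
    rw [add_sub_cancel] at hq
    have hg : (Q *ᵥ xbar + r) ⬝ᵥ (x (k + 1) - xbar) = 0 := by
      refine Finset.sum_eq_zero fun j _ => ?_
      by_cases hj : j ∈ S
      · rw [(hkkt j).2.1 ((hS j).1 hj), zero_mul]
      · rw [hs j hj, mul_zero]
    have hee : (x (k + 1) - xbar) ⬝ᵥ Q *ᵥ (x (k + 1) - xbar) =
        (fun j : {j // j ∈ S} => (x (k + 1) - xbar) j) ⬝ᵥ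
          A *ᵥ (fun j : {j // j ∈ S} => (x (k + 1) - xbar) j) := by
      rw [supp_dot S _ _ hs]
      congr 1
      funext j
      exact supp_mulVec S Q _ hs j
    have hkl := hKL (fun j : {j // j ∈ S} => (x (k + 1) - xbar) j)
    rw [← hee] at hkl
    have hn2 : (A *ᵥ (fun j : {j // j ∈ S} => (x (k + 1) - xbar) j)) ⬝ᵥ
        (A *ᵥ (fun j : {j // j ∈ S} => (x (k + 1) - xbar) j)) ≤
        γ ^ 2 * vnorm (x (k + 1) - x k) ^ 2 := by
      rw [hAe, vnorm_sq']
      simp only [dotProduct]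
      rw [Finset.sum_coe_sort S
        (fun j => -(γ * (x (k + 1) - x k) j) * -(γ * (x (k + 1) - x k) j)), Finset.mul_sum]
      refine (Finset.sum_le_sum_of_subset_of_nonneg (Finset.subset_univ S)
        fun j _ _ => mul_self_nonneg _).trans (le_of_eq ?_)
      exact Finset.sum_congr rfl fun j _ => by ring
    have hd := hdesc k
    rw [div_mul_eq_mul_div, le_div_iff₀ (by linarith)]
    nlinarith
  have hρ0 : 0 < γ / (γ + lam) := by positivity
  have hρ1 : γ / (γ + lam) < 1 := by
    rw [div_lt_one (by positivity)]; linarith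
  set ρ := γ / (γ + lam) with hρ
  have hconv := seq_conv E (fun k => √(qf Q r (x k) - qf Q r xbar)) ε (√(2 / γ)) (√ρ)
    (Real.sqrt_nonneg _) (Real.sqrt_nonneg _)
    (by rw [Real.sqrt_lt' one_pos]; simpa using hρ1)
    (fun k => Real.sqrt_nonneg _)
    (by
      intro k
      have h1 : x (k + 1) - xbar = (x k - xbar) + (x (k + 1) - x k) := by abel
      have h2 : E (k + 1) ≤ E k + vnorm (x (k + 1) - x k) := by
        simp only [hE]
        rw [h1]
        exact vnorm_add_le' _ _
      refine h2.trans (add_le_add le_rfl ?_)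
      rw [← Real.sqrt_mul (by positivity)]
      apply Real.le_sqrt_of_sq_le
      rw [div_mul_eq_mul_div, le_div_iff₀ hγ]
      linarith [hdesc k, hge (k + 1)])
    (by
      intro k h1 h2
      rw [← Real.sqrt_mul hρ0.le]
      exact Real.sqrt_le_sqrt (hcontr k h1 h2))
    (by
      intro δ hδ
      have hEc : Continuous fun y : Fin n → ℝ => vnorm (y - xbar) := by
        unfold vnorm
        simp only [dotProduct]
        fun_prop
      have t1 : Tendsto (fun i => E (φ i)) atTop (𝓝 0) := by
        have := (hEc.tendsto xbar).comp hlim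
        simpa [vnorm, hE, Function.comp_def] using this
      have t2 : Tendsto (fun i => √(qf Q r (x (φ i)) - qf Q r xbar)) atTop (𝓝 0) := by
        have := (hqlim.sub_const (qf Q r xbar)).sqrt
        simpa using this
      obtain ⟨i, h1, h2⟩ := ((t1.eventually_lt_const hδ).and (t2.eventually_lt_const hδ)).exists
      exact ⟨φ i, h1, h2⟩)
  obtain ⟨K, hK⟩ := hconv ε hε le_rfl
  have hsup : ∀ k, K + 1 ≤ k → ∀ j, j ∉ S → (x k - xbar) j = 0 := by
    intro k hk
    obtain ⟨m, rfl⟩ : ∃ m, k = m + 1 := ⟨k - 1, by omega⟩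
    exact (hid' m (hK m (by omega)) (hK _ (by omega))).1
  set e : ℕ → {j // j ∈ S} → ℝ := fun k j => (x k - xbar) j with he
  set c : {j // j ∈ S} → ℕ → ℝ := fun i k => v i ⬝ᵥ e k with hc
  have hrec : ∀ k, K + 1 ≤ k → ∀ i, (γ + μ i) * c i (k + 1) = γ * c i k := by
    intro k hk i
    have h1 := (hid' k (hK k (by omega)) (hK _ (by omega))).2
    have h2 : A *ᵥ e (k + 1) = - (γ • (e (k + 1) - e k)) := by
      rw [he, h1]
      funext j
      simp
    have h3 := hvA i (e (k + 1))
    rw [h2, dotProduct_neg, dotProduct_smul, dotProduct_sub, smul_eq_mul] at h3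
    simp only [hc]
    linarith
  have hEe : ∀ k, K + 1 ≤ k → ∀ i, c i k ^ 2 ≤ E k ^ 2 := by
    intro k hk i
    simp only [hE, vnorm_sq']
    rw [supp_dot S _ _ (hsup k hk), hpars]
    have := Finset.single_le_sum (f := fun i => (v i ⬝ᵥ e k) * (v i ⬝ᵥ e k))
      (fun i _ => mul_self_nonneg _) (Finset.mem_univ i)
    rw [pow_two]
    exact this
  have hzero : ∀ i, μ i ≤ 0 → ∀ k, K + 1 ≤ k → c i k = 0 := by
    intro i hi k hk
    have hmono : ∀ m ≥ k, |c i k| ≤ |c i m| := by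
      intro m hm
      induction m, hm using Nat.le_induction with
      | base => exact le_rfl
      | succ m hm ih =>
        have h1 := congrArg abs (hrec m (by omega) i)
        rw [abs_mul, abs_mul, abs_of_pos (hμ i), abs_of_pos hγ] at h1
        refine ih.trans ?_
        have := abs_nonneg (c i (m + 1))
        nlinarith
    by_contra hne
    have hpos : 0 < |c i k| := abs_pos.2 hne
    obtain ⟨M, hM⟩ := hconv (min ε |c i k|) (lt_min hε hpos) (min_le_left _ _)
    have h1 := hM (max M k) (le_max_left _ _)
    have h2 := hmono (max M k) (le_max_right _ _)
    have h3 := abs_le_of_sq_le_sq (hEe (max M k) (hk.trans (le_max_right _ _)) i)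
      (vnorm_nonneg' _)
    have h4 := min_le_right ε |c i k|
    linarith
  -- contraction of coordinates
  have hcoord : ∀ (a b : Fin n → ℝ), (∀ j, j ∉ S → a j = 0) → (∀ j, j ∉ S → b j = 0) →
      (∀ i, (γ + μ i) * (v i ⬝ᵥ fun j : {j // j ∈ S} => a j) =
        γ * (v i ⬝ᵥ fun j : {j // j ∈ S} => b j)) →
      (∀ i, μ i ≤ 0 → (v i ⬝ᵥ fun j : {j // j ∈ S} => a j) = 0) →
      vnorm a ≤ ρ * vnorm b := by
    intro a b ha hb hab hz
    refine abs_le_of_sq_le_sq' ?_ (mul_nonneg hρ0.le (vnorm_nonneg' b)) |>.2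
    rw [mul_pow, vnorm_sq', vnorm_sq', supp_dot S a a ha, supp_dot S b b hb, hpars, hpars,
      Finset.mul_sum]
    refine Finset.sum_le_sum fun i _ => ?_
    rcases hdich i with h | h
    · rw [hz i h, mul_zero]
      exact mul_nonneg (sq_nonneg _) (mul_self_nonneg _)
    · have h1 : (v i ⬝ᵥ fun j : {j // j ∈ S} => a j) =
          γ / (γ + μ i) * (v i ⬝ᵥ fun j : {j // j ∈ S} => b j) := by
        have := hab i
        have := (hμ i).ne'
        field_simp
        linarith
      have h2 : γ / (γ + μ i) ≤ ρ := by
        rw [hρ]; gcongr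
      have h3 : 0 ≤ γ / (γ + μ i) := (div_pos hγ (hμ i)).le
      rw [h1]
      have h4 : (γ / (γ + μ i)) ^ 2 ≤ ρ ^ 2 := by gcongr
      nlinarith [mul_le_mul_of_nonneg_right h4
        (mul_self_nonneg (v i ⬝ᵥ fun j : {j // j ∈ S} => b j))]
  refine ⟨K + 1, fun k hk => ⟨?_, ?_⟩⟩
  · have hdS : ∀ m, K + 1 ≤ m → ∀ j, j ∉ S → (x (m + 1) - x m) j = 0 := by
      intro m hm j hj
      have h1 := hsup (m + 1) (by omega) j hj
      have h2 := hsup m hm j hj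
      simp only [Pi.sub_apply] at h1 h2 ⊢
      linarith
    have hdc : ∀ m i, (v i ⬝ᵥ fun j : {j // j ∈ S} => (x (m + 1) - x m) j) =
        c i (m + 1) - c i m := by
      intro m i
      simp only [hc]
      rw [← dotProduct_sub]
      congr 1
      funext j
      simp [he]
    refine hcoord _ _ (hdS (k + 1) (by omega)) (hdS k hk) ?_ ?_
    · intro i
      rw [hdc (k + 1) i, hdc k i]
      have h1 := hrec (k + 1) (by omega) i
      have h2 := hrec k hk i
      linarith
    · intro i hi
      rw [hdc (k + 1) i, hzero i hi _ (by omega), hzero i hi _ (by omega), sub_zero]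
  · exact hcoord _ _ (hsup (k + 1) (by omega)) (hsup k hk) (fun i => hrec k hk i)
      (fun i hi => hzero i hi (k + 1) (by omega))
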